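/- arXiv:1001.1624 — 2 statements merged into one kernel-verified Lean document; each statement's English description precedes it below -/
import Mathlib

section
/- Let X be a finite set of unit vectors in R^2 that spans R^2 and satisfies 0 ∈ conv(X). For any valid farthest-point iteration u_0 = 0, u_{i+1} = u_i + χ_i with χ_i ∈ argmin_{x∈X} ⟨x, u_i⟩, one has ‖u_i‖ ≤ √2 for all i. -/
open scoped RealInnerProductSpace

/-- A functional on the plane takes a nonnegative value on any set whose convex hull contains
the origin. -/
lemma exists_nonneg_of_zero_mem_convexHull {X : Set (EuclideanSpace ℝ (Fin 2))}
    (h0 : (0 : EuclideanSpace ℝ (Fin 2)) ∈ convexHull ℝ X) (f g : ℝ) :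
    ∃ x ∈ X, 0 ≤ f * x 0 + g * x 1 := by
  by_contra! h
  have hconv : Convex ℝ {x : EuclideanSpace ℝ (Fin 2) | f * x 0 + g * x 1 < 0} := by
    refine convex_halfSpace_lt (f := fun x : EuclideanSpace ℝ (Fin 2) => f * x 0 + g * x 1)
      ⟨fun x y => ?_, fun c x => ?_⟩ 0
    · simp only [PiLp.add_apply]; ring
    · simp only [PiLp.smul_apply, smul_eq_mul]; ring
  have h00 : f * (0 : EuclideanSpace ℝ (Fin 2)) 0 + g * (0 : EuclideanSpace ℝ (Fin 2)) 1 < 0 :=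
    convexHull_min h hconv h0
  simp at h00

/-- On the unit circle, a point `(ξ, η)` of the upper half that is not to the right of `(β₁, β₂)`
lies below the chord from `(α₁, -α₂)` to `(β₁, β₂)`. -/
lemma below_chord_of_upper {α₁ α₂ β₁ β₂ ξ η : ℝ} (hα : α₁ ^ 2 + α₂ ^ 2 = 1)
    (hβ : β₁ ^ 2 + β₂ ^ 2 = 1) (hξ : ξ ^ 2 + η ^ 2 = 1) (hα₂ : 0 < α₂) (hβ₂ : 0 < β₂)
    (hαβ : α₁ ≤ β₁) (hη : 0 ≤ η) (hξβ : ξ ≤ β₁) :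
    (β₁ - α₁) * (β₂ - η) ≤ (α₂ + β₂) * (β₁ - ξ) := by
  rcases le_or_gt β₂ η with h | h
  · exact (mul_nonpos_of_nonneg_of_nonpos (by linarith) (by linarith)).trans
      (mul_nonneg (by linarith) (by linarith))
  have hξ₁ : -1 ≤ ξ := by nlinarith
  have hα₁ : -1 ≤ α₁ := by nlinarith
  have hβ₁ : β₁ ≤ 1 := by nlinarith
  have hneg : β₁ + ξ ≤ 0 := by
    by_contra! hc
    nlinarith [mul_nonneg (sub_nonneg.2 hξβ) hc.le]
  have key : (β₁ - α₁) * (-β₁ - ξ) ≤ (α₂ + β₂) * (β₂ + η) := by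
    have h₁ : (β₁ - α₁) * (-β₁ - ξ) ≤ (β₁ + 1) * (1 - β₁) :=
      mul_le_mul (by linarith) (by linarith) (by linarith) (by linarith)
    nlinarith [mul_pos hα₂ hβ₂, mul_nonneg hα₂.le hη, mul_nonneg hβ₂.le hη]
  have hpos : 0 < β₂ + η := by linarith
  have heq : (β₂ - η) * (β₂ + η) = (β₁ - ξ) * (-β₁ - ξ) := by linarith
  refine le_of_mul_le_mul_right ?_ hpos
  calc (β₁ - α₁) * (β₂ - η) * (β₂ + η) = (β₁ - ξ) * ((β₁ - α₁) * (-β₁ - ξ)) := by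
        rw [mul_assoc, heq]; ring
    _ ≤ (β₁ - ξ) * ((α₂ + β₂) * (β₂ + η)) := mul_le_mul_of_nonneg_left key (by linarith)
    _ = (α₂ + β₂) * (β₁ - ξ) * (β₂ + η) := by ring

/-- On the unit circle, a point `(ξ, -η)` of the lower half that is not to the right of
`(α₁, -α₂)` lies below the chord from `(α₁, -α₂)` to `(β₁, β₂)`, for small `β₁`. -/
lemma below_chord_of_lower {α₁ α₂ β₁ β₂ ξ η : ℝ} (hα : α₁ ^ 2 + α₂ ^ 2 = 1)
    (hξ : ξ ^ 2 + η ^ 2 = 1) (hα₂ : 0 < α₂) (hβ₂ : 0 < β₂) (hβ₀ : 0 ≤ β₁)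
    (hβ₁ : 8 * β₁ ^ 2 ≤ 1) (hαβ : α₁ ≤ β₁) (hη : 0 < η) (hξα : ξ ≤ α₁) :
    (β₁ - α₁) * (η - α₂) ≤ (α₂ + β₂) * (α₁ - ξ) := by
  rcases le_or_gt η α₂ with h | h
  · exact (mul_nonpos_of_nonneg_of_nonpos (by linarith) (by linarith)).trans
      (mul_nonneg (by linarith) (by linarith))
  have hα₁ : 0 ≤ α₁ := by
    by_contra! hc
    nlinarith
  have key : (β₁ - α₁) * (α₁ + ξ) ≤ (α₂ + β₂) * (η + α₂) := by
    have h₁ : (β₁ - α₁) * (α₁ + ξ) ≤ β₁ * (2 * β₁) :=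
      (mul_le_mul_of_nonneg_left (by linarith) (by linarith)).trans
        (mul_le_mul_of_nonneg_right (by linarith) (by linarith))
    nlinarith [mul_pos hα₂ hη, mul_pos hβ₂ hη, mul_pos hβ₂ hα₂]
  have hpos : 0 < η + α₂ := by linarith
  have heq : (η - α₂) * (η + α₂) = (α₁ - ξ) * (α₁ + ξ) := by linarith
  refine le_of_mul_le_mul_right ?_ hpos
  calc (β₁ - α₁) * (η - α₂) * (η + α₂) = (α₁ - ξ) * ((β₁ - α₁) * (α₁ + ξ)) := by
        rw [mul_assoc, heq]; ring
    _ ≤ (α₁ - ξ) * ((α₂ + β₂) * (η + α₂)) := mul_le_mul_of_nonneg_left key (by linarith)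
    _ = (α₂ + β₂) * (α₁ - ξ) * (η + α₂) := by ring

/-- The unit vector `(p, q)` is the midpoint of a wide gap of `X` on the circle, with endpoints
`a` and `b`: every point of `X` has component at most `c ≤ 1 / √2` along `(p, q)`, with equality
at `a` and `b`, which are mirror images of each other. -/
structure IsWideGap (X : Finset (EuclideanSpace ℝ (Fin 2))) (p q c : ℝ)
    (a b : EuclideanSpace ℝ (Fin 2)) : Prop where
  unit : p ^ 2 + q ^ 2 = 1
  nonneg : 0 ≤ c
  small : 2 * c ^ 2 ≤ 1
  le : ∀ x ∈ X, p * x 0 + q * x 1 ≤ c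
  left_mem : a ∈ X
  right_mem : b ∈ X
  left_eq : p * a 0 + q * a 1 = c
  right_eq : p * b 0 + q * b 1 = c
  mirror : (p * a 1 - q * a 0) + (p * b 1 - q * b 0) = 0

/-- If every point of `X` makes a large angle with the unit vector `m` and `b ∈ X` is closest
to `m`, then `m` lies in a wide gap of `X` with endpoint `b`. -/
lemma exists_isWideGap {X : Finset (EuclideanSpace ℝ (Fin 2))}
    (hX : ∀ x ∈ X, x 0 ^ 2 + x 1 ^ 2 = 1)
    (h0 : (0 : EuclideanSpace ℝ (Fin 2)) ∈ convexHull ℝ (X : Set (EuclideanSpace ℝ (Fin 2))))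
    {m₀ m₁ : ℝ} (hm : m₀ ^ 2 + m₁ ^ 2 = 1) {b : EuclideanSpace ℝ (Fin 2)} (hb : b ∈ X)
    (hmax : ∀ x ∈ X, m₀ * x 0 + m₁ * x 1 ≤ m₀ * b 0 + m₁ * b 1)
    (hsmall : 8 * (m₀ * b 0 + m₁ * b 1) ^ 2 ≤ 1) :
    ∃ p q c a, IsWideGap X p q c a b ∧ 0 ≤ p * m₀ + q * m₁ := by
  have hβ₀ : 0 ≤ m₀ * b 0 + m₁ * b 1 := by
    obtain ⟨x, hx, hx0⟩ := exists_nonneg_of_zero_mem_convexHull h0 m₀ m₁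
    exact hx0.trans (hmax x hx)
  obtain ⟨ε, hε, hDb⟩ : ∃ ε : ℝ, ε ^ 2 = 1 ∧ 0 < ε * (m₀ * b 1 - m₁ * b 0) := by
    have hne : m₀ * b 1 - m₁ * b 0 ≠ 0 := by
      intro h
      have : (m₀ * b 0 + m₁ * b 1) ^ 2 + (m₀ * b 1 - m₁ * b 0) ^ 2 = 1 := by
        linear_combination (b 0 ^ 2 + b 1 ^ 2) * hm + hX b hb
      rw [h] at this
      linarith
    rcases hne.lt_or_gt with h | h
    · exact ⟨-1, by norm_num, by linarith⟩
    · exact ⟨1, by norm_num, by linarith⟩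
  set D : EuclideanSpace ℝ (Fin 2) → ℝ := fun x => ε * (m₀ * x 1 - m₁ * x 0) with hD
  set M : EuclideanSpace ℝ (Fin 2) → ℝ := fun x => m₀ * x 0 + m₁ * x 1 with hM
  have hMD : ∀ x ∈ X, M x ^ 2 + D x ^ 2 = 1 := fun x hx => by
    simp only [hM, hD]
    linear_combination (m₀ * x 1 - m₁ * x 0) ^ 2 * hε + (x 0 ^ 2 + x 1 ^ 2) * hm + hX x hx
  change 0 < D b at hDb
  change 0 ≤ M b at hβ₀
  change ∀ x ∈ X, M x ≤ M b at hmax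
  change 8 * M b ^ 2 ≤ 1 at hsmall
  obtain ⟨a, ha, hamax⟩ : ∃ a ∈ X.filter (fun x => D x < 0),
      ∀ x ∈ X.filter (fun x => D x < 0), M x ≤ M a := by
    apply Finset.exists_max_image
    obtain ⟨x, hx, hx0⟩ := exists_nonneg_of_zero_mem_convexHull h0
      (m₀ + ε * m₁) (m₁ - ε * m₀)
    refine ⟨x, Finset.mem_filter.2 ⟨hx, ?_⟩⟩
    by_contra! hc
    have h₁ : D x ≤ M x := by simp only [hM, hD]; linarith
    have h₂ := hMD x hx
    have h₃ := hmax x hx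
    nlinarith
  obtain ⟨haX, hDa⟩ := Finset.mem_filter.1 ha
  have hF : ∀ x : EuclideanSpace ℝ (Fin 2), ε * (b 1 - a 1) * x 0 + -ε * (b 0 - a 0) * x 1
      = (D b - D a) * M x + (M a - M b) * D x := fun x => by
    simp only [hM, hD]
    linear_combination -(ε * (b 1 - a 1) * x 0 - ε * (b 0 - a 0) * x 1) * hm
  have hFa : (D b - D a) * M a + (M a - M b) * D a = M a * D b - M b * D a := by ring
  have hle : ∀ x ∈ X, (D b - D a) * M x + (M a - M b) * D x ≤ M a * D b - M b * D a := by
    intro x hx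
    have hα : M a ^ 2 + (-D a) ^ 2 = 1 := by rw [neg_sq]; exact hMD a haX
    rcases le_or_gt 0 (D x) with h | h
    · have := below_chord_of_upper hα (hMD b hb) (hMD x hx) (neg_pos.2 hDa) hDb
        (hmax a haX) h (hmax x hx)
      linarith
    · have := below_chord_of_lower hα
        (by rw [neg_sq]; exact hMD x hx : M x ^ 2 + (-D x) ^ 2 = 1) (neg_pos.2 hDa) hDb hβ₀ hsmall
        (hmax a haX) (neg_pos.2 h) (hamax x (Finset.mem_filter.2 ⟨hx, h⟩))
      linarith
  have hC0 : 0 ≤ M a * D b - M b * D a := by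
    obtain ⟨x, hx, hx0⟩ := exists_nonneg_of_zero_mem_convexHull h0
      (ε * (b 1 - a 1)) (-ε * (b 0 - a 0))
    rw [hF] at hx0
    exact hx0.trans (hle x hx)
  have hS : 0 < D b - D a := by linarith
  have hN : (b 0 - a 0) ^ 2 + (b 1 - a 1) ^ 2 = (D b - D a) ^ 2 + (M a - M b) ^ 2 := by
    simp only [hM, hD]
    linear_combination (-(m₀ * (b 1 - a 1) - m₁ * (b 0 - a 0)) ^ 2) * hε
      - ((b 0 - a 0) ^ 2 + (b 1 - a 1) ^ 2) * hm
  have hQ : 0 < (b 0 - a 0) ^ 2 + (b 1 - a 1) ^ 2 := by rw [hN]; positivity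
  set L := Real.sqrt ((b 0 - a 0) ^ 2 + (b 1 - a 1) ^ 2) with hL
  have hL0 : 0 < L := Real.sqrt_pos.2 hQ
  have hL2 : L ^ 2 = (b 0 - a 0) ^ 2 + (b 1 - a 1) ^ 2 := Real.sq_sqrt hQ.le
  have hFdiv : ∀ x : EuclideanSpace ℝ (Fin 2), ε * (b 1 - a 1) / L * x 0
      + -ε * (b 0 - a 0) / L * x 1 = ((D b - D a) * M x + (M a - M b) * D x) / L := fun x => by
    rw [← hF]; ring
  refine ⟨ε * (b 1 - a 1) / L, -ε * (b 0 - a 0) / L, (M a * D b - M b * D a) / L, a,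
    ⟨?_, by positivity, ?_, ?_, haX, hb, ?_, ?_, ?_⟩, ?_⟩
  · rw [div_pow, div_pow, ← add_div, div_eq_one_iff_eq (by positivity), hL2]
    linear_combination ((b 0 - a 0) ^ 2 + (b 1 - a 1) ^ 2) * hε
  · have h₁ : M a * D b - M b * D a ≤ M b * (D b - D a) := by nlinarith [hmax a haX]
    have h₂ : (M a * D b - M b * D a) ^ 2 ≤ (M b * (D b - D a)) ^ 2 := by gcongr
    rw [div_pow, ← mul_div_assoc, div_le_one (by positivity), hL2, hN]
    nlinarith [mul_le_mul_of_nonneg_right hsmall (sq_nonneg (D b - D a)), sq_nonneg (M a - M b),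
      sq_nonneg (D b - D a)]
  · intro x hx
    rw [hFdiv]
    exact div_le_div_of_nonneg_right (hle x hx) hL0.le
  · rw [hFdiv, hFa]
  · rw [hFdiv]; congr 1; ring
  · field_simp
    linear_combination ε * (hX b hb - hX a haX)
  · have : ε * (b 1 - a 1) / L * m₀ + -ε * (b 0 - a 0) / L * m₁ = (D b - D a) / L := by
      simp only [hD]; ring
    rw [this]; positivity

/-- In the frame of a wide gap with endpoints `(± s, c)`, a step from `(-X, -Y)` in the lower
half plane keeps the height at least `-1`. -/
lemma sub_le_one_of_step {c s X Y k h : ℝ} (hc : 0 ≤ c) (hs : 0 ≤ s) (hcs : c ^ 2 + s ^ 2 = 1)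
    (hc2 : 2 * c ^ 2 ≤ 1) (hX : 0 ≤ X) (hY : 0 ≤ Y) (hY1 : Y ≤ 1) (hXY : X ^ 2 + Y ^ 2 ≤ 2)
    (hk : k ^ 2 + h ^ 2 = 1) (hmax : s * X + c * Y ≤ k * X + h * Y) : Y - h ≤ 1 := by
  rcases le_or_gt 0 h with h0 | h0
  · linarith
  rcases hY.eq_or_lt with rfl | hYpos
  · nlinarith
  have hp : 0 < (c - h) * Y := mul_pos (by linarith) hYpos
  have hks : s < k := by
    by_contra! hcon
    nlinarith
  have h₁ : (c - h) * (Y * (k + s)) ≤ (c - h) * ((c + h) * X) := by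
    have : (c - h) * Y * (k + s) ≤ (k - s) * X * (k + s) :=
      mul_le_mul_of_nonneg_right (by linarith) (by linarith)
    have hfac : (k - s) * (k + s) = (c - h) * (c + h) := by linarith
    linear_combination this + X * hfac
  have h₂ : Y * (k + s) ≤ (c + h) * X := le_of_mul_le_mul_left h₁ (by linarith)
  have hX2 : X ≤ 2 * s := abs_le_of_sq_le_sq' (by nlinarith) (by linarith) |>.2
  have hspos : 0 < s := by nlinarith
  have hch : 0 ≤ c + h := by nlinarith
  have h₃ : Y ≤ c + h := by
    refine le_of_mul_le_mul_right ?_ (by linarith : 0 < 2 * s)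
    nlinarith
  nlinarith

lemma IsWideGap.neg_one_le_step {X : Finset (EuclideanSpace ℝ (Fin 2))} {p q c : ℝ}
    {a b u χ : EuclideanSpace ℝ (Fin 2)} (hG : IsWideGap X p q c a b)
    (hX : ∀ x ∈ X, x 0 ^ 2 + x 1 ^ 2 = 1) (hχ : χ ∈ X)
    (hmin : ∀ x ∈ X, χ 0 * u 0 + χ 1 * u 1 ≤ x 0 * u 0 + x 1 * u 1)
    (hu : u 0 ^ 2 + u 1 ^ 2 ≤ 2) (hbelow : -1 ≤ p * u 0 + q * u 1) :
    -1 ≤ p * (u 0 + χ 0) + q * (u 1 + χ 1) := by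
  obtain ⟨hpq, hc, hc2, -, ha, hb, hac, hbc, hmir⟩ := hG
  have hpyth : ∀ x : EuclideanSpace ℝ (Fin 2),
      (p * x 1 - q * x 0) ^ 2 + (p * x 0 + q * x 1) ^ 2 = x 0 ^ 2 + x 1 ^ 2 := fun x => by
    linear_combination (x 0 ^ 2 + x 1 ^ 2) * hpq
  have hinner : ∀ x : EuclideanSpace ℝ (Fin 2), x 0 * u 0 + x 1 * u 1
      = (p * x 1 - q * x 0) * (p * u 1 - q * u 0)
        + (p * x 0 + q * x 1) * (p * u 0 + q * u 1) := fun x => by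
    linear_combination -(x 0 * u 0 + x 1 * u 1) * hpq
  have hχ1 := (hpyth χ).trans (hX χ hχ)
  have ha1 := (hpyth a).trans (hX a ha)
  have hu2 := (hpyth u).trans_le hu
  have hma := hmin a ha
  have hmb := hmin b hb
  rw [hinner χ, hinner a] at hma
  rw [hinner χ, hinner b] at hmb
  rw [hac] at hma ha1
  rw [hbc, eq_neg_of_add_eq_zero_right hmir] at hmb
  have hgoal : p * (u 0 + χ 0) + q * (u 1 + χ 1)
      = (p * u 0 + q * u 1) + (p * χ 0 + q * χ 1) := by ring
  rw [hgoal]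
  generalize p * a 1 - q * a 0 = A at *
  generalize p * u 1 - q * u 0 = U at *
  generalize p * χ 1 - q * χ 0 = K at *
  generalize p * χ 0 + q * χ 1 = h at *
  generalize p * u 0 + q * u 1 = V at *
  rcases le_or_gt 0 V with hV | hV
  · nlinarith
  have hcs : c ^ 2 + |A| ^ 2 = 1 := by rw [sq_abs]; linarith
  have hAU : K * U + h * V ≤ -(|A| * |U|) + c * V := by
    rw [← abs_mul]
    rcases abs_cases (A * U) with h | h <;> rw [h.1] <;> linarith
  have hKU : -(K * U) ≤ |K| * |U| := by rw [← abs_mul]; exact neg_le_abs _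
  have := sub_le_one_of_step (Y := -V) (k := |K|) (h := h) hc (abs_nonneg A) hcs hc2
    (abs_nonneg U) (by linarith) (by linarith) (by rw [sq_abs]; linarith)
    (by rw [sq_abs]; linarith) (by linarith)
  linarith

lemma IsWideGap.step_sq_le_two {X : Finset (EuclideanSpace ℝ (Fin 2))} {p q c : ℝ}
    {a b u : EuclideanSpace ℝ (Fin 2)} (hG : IsWideGap X p q c a b)
    (hX : ∀ x ∈ X, x 0 ^ 2 + x 1 ^ 2 = 1)
    (hmin : b 0 * u 0 + b 1 * u 1 ≤ a 0 * u 0 + a 1 * u 1)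
    (hu : u 0 ^ 2 + u 1 ^ 2 ≤ 2) (hbelow : -1 ≤ p * u 0 + q * u 1)
    (habove : p * u 0 + q * u 1 ≤ 0) :
    (u 0 + b 0) ^ 2 + (u 1 + b 1) ^ 2 ≤ 2 := by
  obtain ⟨hpq, hc, hc2, -, ha, hb, hac, hbc, hmir⟩ := hG
  have hpyth : ∀ x y : ℝ, (p * y - q * x) ^ 2 + (p * x + q * y) ^ 2 = x ^ 2 + y ^ 2 :=
    fun x y => by linear_combination (x ^ 2 + y ^ 2) * hpq
  have hinner : ∀ x : EuclideanSpace ℝ (Fin 2), x 0 * u 0 + x 1 * u 1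
      = (p * x 1 - q * x 0) * (p * u 1 - q * u 0)
        + (p * x 0 + q * x 1) * (p * u 0 + q * u 1) := fun x => by
    linear_combination -(x 0 * u 0 + x 1 * u 1) * hpq
  have hb1 := (hpyth _ _).trans (hX b hb)
  have hu2 := (hpyth _ _).trans_le hu
  rw [hinner a, hinner b, hac, hbc, eq_neg_of_add_eq_zero_left hmir] at hmin
  rw [hbc] at hb1
  have hgoal : (u 0 + b 0) ^ 2 + (u 1 + b 1) ^ 2
      = ((p * u 1 - q * u 0) + (p * b 1 - q * b 0)) ^ 2 + ((p * u 0 + q * u 1) + c) ^ 2 := by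
    rw [← hpyth, ← hbc]; ring
  rw [hgoal]
  generalize p * b 1 - q * b 0 = B at *
  generalize p * u 1 - q * u 0 = U at *
  generalize p * u 0 + q * u 1 = V at *
  have hBU : |B| * |U| = -(B * U) := by
    rw [← abs_mul, abs_of_nonpos (by linarith)]
  have hU2 : |U| ≤ 2 * |B| := by
    refine (abs_le_of_sq_le_sq' ?_ (by positivity)).2
    rw [mul_pow, sq_abs, sq_abs]; nlinarith
  have h₁ : U ^ 2 + 2 * (B * U) ≤ 0 := by
    have := mul_le_mul_of_nonneg_right hU2 (abs_nonneg U)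
    rw [abs_mul_abs_self] at this
    linarith
  nlinarith

/-- For a finite set `X` of unit vectors spanning `ℝ²` with `0 ∈ conv X`, every
valid farthest-point iteration stays within the ball of radius `√2`. -/
theorem stmt9 (X : Finset (EuclideanSpace ℝ (Fin 2)))
    (hunit : ∀ x ∈ X, ‖x‖ = 1)
    (hspan : Submodule.span ℝ (X : Set (EuclideanSpace ℝ (Fin 2))) = ⊤)
    (h0 : (0 : EuclideanSpace ℝ (Fin 2)) ∈ convexHull ℝ (X : Set (EuclideanSpace ℝ (Fin 2))))
    (u : ℕ → EuclideanSpace ℝ (Fin 2)) (hu0 : u 0 = 0)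
    (hstep : ∀ i, ∃ χ ∈ X, (∀ x ∈ X, ⟪χ, u i⟫ ≤ ⟪x, u i⟫) ∧ u (i + 1) = u i + χ) :
    ∀ i, ‖u i‖ ≤ Real.sqrt 2 := by
  have hnorm : ∀ x : EuclideanSpace ℝ (Fin 2), ‖x‖ ^ 2 = x 0 ^ 2 + x 1 ^ 2 := fun x => by
    rw [EuclideanSpace.norm_sq_eq, Fin.sum_univ_two, Real.norm_eq_abs, Real.norm_eq_abs, sq_abs,
      sq_abs]
  have hinner : ∀ x y : EuclideanSpace ℝ (Fin 2), ⟪x, y⟫ = x 0 * y 0 + x 1 * y 1 := fun x y => by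
    rw [PiLp.inner_apply, Fin.sum_univ_two]
    simp [mul_comm]
  have hX : ∀ x ∈ X, x 0 ^ 2 + x 1 ^ 2 = 1 := fun x hx => by
    rw [← hnorm, hunit x hx, one_pow]
  suffices hinv : ∀ i, u i 0 ^ 2 + u i 1 ^ 2 ≤ 2 ∧
      ∀ p q c a b, IsWideGap X p q c a b → -1 ≤ p * u i 0 + q * u i 1 by
    intro i
    apply Real.le_sqrt_of_sq_le
    rw [hnorm]
    exact (hinv i).1
  intro i
  induction i with
  | zero => simp [hu0]
  | succ i ih =>
    obtain ⟨hu, hgap⟩ := ih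
    obtain ⟨χ, hχ, hmin, hnext⟩ := hstep i
    simp only [hinner] at hmin
    simp only [hnext, PiLp.add_apply]
    refine ⟨?_, fun p q c a b hG => hG.neg_one_le_step hX hχ hmin hu (hgap p q c a b hG)⟩
    generalize u i = v at *
    by_contra! hbad
    have hχ1 := hX χ hχ
    have hneg : χ 0 * v 0 + χ 1 * v 1 ≤ 0 := by
      obtain ⟨x, hx, hx0⟩ := exists_nonneg_of_zero_mem_convexHull h0 (-v 0) (-v 1)
      linarith [hmin x hx]
    set r := ‖v‖ with hr
    have hr2 : r ^ 2 = v 0 ^ 2 + v 1 ^ 2 := hnorm v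
    have hr1 : 1 < r ^ 2 := by nlinarith
    have hrpos : 0 < r := by
      by_contra! h
      rw [le_antisymm h (norm_nonneg v)] at hr1
      norm_num at hr1
    have hdiv : ∀ x y : ℝ, -v 0 / r * x + -v 1 / r * y = -(x * v 0 + y * v 1) / r :=
      fun x y => by ring
    obtain ⟨p, q, c, a, hG, hpos⟩ := exists_isWideGap hX h0 (m₀ := -v 0 / r) (m₁ := -v 1 / r)
      (by rw [div_pow, div_pow, ← add_div, div_eq_one_iff_eq (by positivity), hr2]; ring) hχ
      (fun x hx => by
        rw [hdiv, hdiv]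
        exact div_le_div_of_nonneg_right (neg_le_neg (hmin x hx)) hrpos.le)
      (by
        rw [hdiv, div_pow, ← mul_div_assoc, div_le_one (by positivity), neg_sq]
        have h₁ : -(2 * (χ 0 * v 0 + χ 1 * v 1)) ≤ r ^ 2 - 1 := by nlinarith
        have h₂ : (-(2 * (χ 0 * v 0 + χ 1 * v 1))) ^ 2 ≤ (r ^ 2 - 1) ^ 2 :=
          pow_le_pow_left₀ (by linarith) h₁ 2
        nlinarith)
    have habove : p * v 0 + q * v 1 ≤ 0 := by
      have : p * (-v 0 / r) + q * (-v 1 / r) = -(p * v 0 + q * v 1) / r := by ring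
      rw [this] at hpos
      have := (le_div_iff₀ hrpos).1 hpos
      linarith
    exact hbad.not_ge (hG.step_sq_le_two hX (hmin a hG.left_mem) hu (hgap p q c a χ hG) habove)
end

section
/- For every M > 0 and every d ≥ 3, there exists a finite d-balanced (i.e. 0 is interior to the convex hull) set X of unit vectors in R^d with u*(X) ≥ √M. Consequently u**(d, d) = ∞ for d ≥ 3. -/
open scoped RealInnerProductSpace

/-- A convex set containing positive and negative multiples of every standard basis vector is a
neighbourhood of `0`. -/
theorem Convex.zero_mem_interior_of_single_mem {d : ℕ} (hd : 0 < d)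
    {C : Set (EuclideanSpace ℝ (Fin d))} (hC : Convex ℝ C)
    (h : ∀ i, ∃ t : ℝ, 0 < t ∧ EuclideanSpace.single i t ∈ C ∧ EuclideanSpace.single i (-t) ∈ C) :
    (0 : EuclideanSpace ℝ (Fin d)) ∈ interior C := by
  choose t ht hp hn using h
  have hd' : (0 : ℝ) < d := by exact_mod_cast hd
  rw [mem_interior_iff_mem_nhds]
  have key : ∀ᶠ x : EuclideanSpace ℝ (Fin d) in nhds 0, ∀ i, |d * x i| < t i := by
    rw [Filter.eventually_all]
    intro i
    have hc : Continuous fun x : EuclideanSpace ℝ (Fin d) => |d * x i| := by fun_prop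
    exact hc.continuousAt.eventually_lt continuousAt_const (by simpa using ht i)
  filter_upwards [key] with x hx
  have hmem : ∀ i, EuclideanSpace.single i (d * x i) ∈ C := by
    intro i
    have h1 := abs_lt.1 (hx i)
    have h2 := ht i
    have h3 := hC (hp i) (hn i) (a := (t i + d * x i) / (2 * t i))
      (b := (t i - d * x i) / (2 * t i))
      (div_nonneg (by linarith) (by linarith)) (div_nonneg (by linarith) (by linarith))
      (by field_simp; ring)
    convert h3 using 1
    ext j
    by_cases hj : j = i
    · subst hj
      simp
      field_simp
      ring
    · simp [hj]
  have hsum : x = ∑ i, (1 / d : ℝ) • EuclideanSpace.single i (d * x i) := by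
    ext j
    simp [Pi.single_apply]
    field_simp
  rw [hsum]
  exact hC.sum_mem (fun _ _ => by positivity) (by simp; field_simp) fun i _ => hmem i

/-- A finite initial segment of a greedy trajectory extends to an infinite one. -/
theorem exists_greedy_extension {E : Type*} [NormedAddCommGroup E] [InnerProductSpace ℝ E]
    (X : Finset E) (hX : X.Nonempty) (a : ℕ → E) (N : ℕ)
    (ha : ∀ k < N, ∃ χ ∈ X, (∀ x ∈ X, ⟪χ, a k⟫ ≤ ⟪x, a k⟫) ∧ a (k + 1) = a k + χ) :
    ∃ u : ℕ → E, (∀ k ≤ N, u k = a k) ∧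
      ∀ k, ∃ χ ∈ X, (∀ x ∈ X, ⟪χ, u k⟫ ≤ ⟪x, u k⟫) ∧ u (k + 1) = u k + χ := by
  choose g hgX hg using fun w : E => X.exists_min_image (fun x => ⟪x, w⟫) hX
  refine ⟨fun k => (fun w => w + g w)^[k - N] (a (min k N)), fun k hk => ?_, fun k => ?_⟩
  · simp [Nat.sub_eq_zero_of_le hk, min_eq_left hk]
  · rcases lt_or_ge k N with hk | hk
    · have h1 : k - N = 0 := by omega
      have h2 : k + 1 - N = 0 := by omega
      simpa only [h1, h2, Function.iterate_zero, id, min_eq_left hk.le,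
        min_eq_left (Nat.succ_le_of_lt hk)] using ha k hk
    · have h1 : k + 1 - N = (k - N) + 1 := by omega
      refine ⟨_, hgX _, hg _, ?_⟩
      simp only [h1, Function.iterate_succ_apply', min_eq_right hk,
        min_eq_right (Nat.le_succ_of_le hk)]

theorem norm_single_add_single {d : ℕ} {i j : Fin d} (hij : i ≠ j) {a b : ℝ}
    (hab : a ^ 2 + b ^ 2 = 1) :
    ‖(EuclideanSpace.single i a + EuclideanSpace.single j b : EuclideanSpace ℝ (Fin d))‖ = 1 := by
  have h : ‖(EuclideanSpace.single i a + EuclideanSpace.single j b :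
      EuclideanSpace ℝ (Fin d))‖ ^ 2 = 1 := by
    rw [norm_add_sq_real]
    simp [EuclideanSpace.inner_single_left, hij, hab]
  exact (pow_eq_one_iff_of_nonneg (norm_nonneg _) two_ne_zero).1 h

/-- The steps available to the greedy iteration: the starting step `(c / 2, s)`, the rising steps
`(± c, ε)` in the plane of the coordinates `o, v`, and the steps `(± c, ± ε)` in the planes of the
other coordinates and `v`. -/
def greedySteps {d : ℕ} (o v : Fin d) (c s ε : ℝ) : Set (EuclideanSpace ℝ (Fin d)) :=
  {EuclideanSpace.single o (c / 2) + EuclideanSpace.single v s,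
    EuclideanSpace.single o c + EuclideanSpace.single v ε,
    EuclideanSpace.single o (-c) + EuclideanSpace.single v ε} ∪
  {x | ∃ i : Fin d, (i ≠ o ∧ i ≠ v) ∧
    (x = EuclideanSpace.single i c + EuclideanSpace.single v ε ∨
     x = EuclideanSpace.single i c + EuclideanSpace.single v (-ε) ∨
     x = EuclideanSpace.single i (-c) + EuclideanSpace.single v ε ∨
     x = EuclideanSpace.single i (-c) + EuclideanSpace.single v (-ε))}

section greedySteps

variable {d : ℕ} {o v : Fin d} {c s ε : ℝ}

theorem greedySteps_finite : (greedySteps o v c s ε).Finite := by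
  refine Set.Finite.union (by simp) ?_
  refine (Set.finite_iUnion fun i : Fin d => Set.toFinite
    ({EuclideanSpace.single i c + EuclideanSpace.single v ε,
      EuclideanSpace.single i c + EuclideanSpace.single v (-ε),
      EuclideanSpace.single i (-c) + EuclideanSpace.single v ε,
      EuclideanSpace.single i (-c) + EuclideanSpace.single v (-ε)} :
        Set (EuclideanSpace ℝ (Fin d)))).subset ?_
  rintro x ⟨i, -, h⟩
  exact Set.mem_iUnion.2 ⟨i, h⟩

theorem norm_of_mem_greedySteps (hov : o ≠ v) (hc : c ^ 2 + ε ^ 2 = 1)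
    (hs : (c / 2) ^ 2 + s ^ 2 = 1) {x : EuclideanSpace ℝ (Fin d)}
    (hx : x ∈ greedySteps o v c s ε) : ‖x‖ = 1 := by
  rcases hx with (rfl | rfl | rfl) | ⟨i, ⟨-, hiv⟩, rfl | rfl | rfl | rfl⟩
  · exact norm_single_add_single hov hs
  · exact norm_single_add_single hov hc
  · exact norm_single_add_single hov (by rw [neg_sq, hc])
  all_goals exact norm_single_add_single hiv (by simpa using hc)

theorem zero_mem_interior_convexHull_greedySteps (hov : o ≠ v) {p : Fin d} (hpo : p ≠ o)
    (hpv : p ≠ v) (hc : 0 < c) (hε : 0 < ε) :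
    (0 : EuclideanSpace ℝ (Fin d)) ∈ interior (convexHull ℝ (greedySteps o v c s ε)) := by
  have hC := convex_convexHull ℝ (greedySteps o v c s ε)
  have hsub := subset_convexHull ℝ (greedySteps o v c s ε)
  have mid : ∀ x ∈ convexHull ℝ (greedySteps o v c s ε),
      ∀ y ∈ convexHull ℝ (greedySteps o v c s ε),
      (1 / 2 : ℝ) • x + (1 / 2 : ℝ) • y ∈ convexHull ℝ (greedySteps o v c s ε) :=
    fun x hx y hy => hC hx hy (by norm_num) (by norm_num) (by norm_num)
  have pp : ∀ i, i ≠ o → i ≠ v → EuclideanSpace.single i c + EuclideanSpace.single v ε ∈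
      convexHull ℝ (greedySteps o v c s ε) :=
    fun i h1 h2 => hsub (Or.inr ⟨i, ⟨h1, h2⟩, by simp⟩)
  have pn : ∀ i, i ≠ o → i ≠ v → EuclideanSpace.single i c + EuclideanSpace.single v (-ε) ∈
      convexHull ℝ (greedySteps o v c s ε) :=
    fun i h1 h2 => hsub (Or.inr ⟨i, ⟨h1, h2⟩, by simp⟩)
  have np : ∀ i, i ≠ o → i ≠ v → EuclideanSpace.single i (-c) + EuclideanSpace.single v ε ∈
      convexHull ℝ (greedySteps o v c s ε) :=
    fun i h1 h2 => hsub (Or.inr ⟨i, ⟨h1, h2⟩, by simp⟩)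
  have nn : ∀ i, i ≠ o → i ≠ v → EuclideanSpace.single i (-c) + EuclideanSpace.single v (-ε) ∈
      convexHull ℝ (greedySteps o v c s ε) :=
    fun i h1 h2 => hsub (Or.inr ⟨i, ⟨h1, h2⟩, by simp⟩)
  have hvp : EuclideanSpace.single v ε ∈ convexHull ℝ (greedySteps o v c s ε) := by
    convert mid _ (pp p hpo hpv) _ (np p hpo hpv) using 1
    ext j
    simp
    split_ifs <;> ring
  have hvn : EuclideanSpace.single v (-ε) ∈ convexHull ℝ (greedySteps o v c s ε) := by
    convert mid _ (pn p hpo hpv) _ (nn p hpo hpv) using 1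
    ext j
    simp
    split_ifs <;> ring
  refine hC.zero_mem_interior_of_single_mem o.pos fun i => ?_
  by_cases hiv : i = v
  · subst hiv
    exact ⟨ε, hε, hvp, hvn⟩
  by_cases hio : i = o
  · subst hio
    refine ⟨c / 2, by positivity, ?_, ?_⟩
    · convert mid _ (hsub (Or.inl (by simp) :
        EuclideanSpace.single i c + EuclideanSpace.single v ε ∈ _)) _ hvn using 1
      ext j
      simp
      split_ifs <;> ring
    · convert mid _ (hsub (Or.inl (by simp) :
        EuclideanSpace.single i (-c) + EuclideanSpace.single v ε ∈ _)) _ hvn using 1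
      ext j
      simp
      split_ifs <;> ring
  · refine ⟨c, hc, ?_, ?_⟩
    · convert mid _ (pp i hio hiv) _ (pn i hio hiv) using 1
      ext j
      simp
      split_ifs <;> ring
    · convert mid _ (np i hio hiv) _ (nn i hio hiv) using 1
      ext j
      simp
      split_ifs <;> ring

/-- At `(± c / 2, h)` with `h` not too large, the rising step towards the `v`-axis is greedy. -/
theorem greedySteps_min (hov : o ≠ v) (hε : 0 < ε) (hεs : ε ≤ s) {h σ : ℝ} (h0 : 0 ≤ h)
    (hh : ε * h ≤ c ^ 2 / 4) (hσ : σ = 1 ∨ σ = -1) {x : EuclideanSpace ℝ (Fin d)}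
    (hx : x ∈ greedySteps o v c s ε) :
    ⟪EuclideanSpace.single o (-(σ * c)) + EuclideanSpace.single v ε,
      EuclideanSpace.single o (σ * (c / 2)) + EuclideanSpace.single v h⟫ ≤
    ⟪x, EuclideanSpace.single o (σ * (c / 2)) + EuclideanSpace.single v h⟫ := by
  have hεh : 0 ≤ ε * h := by positivity
  have hsh : ε * h ≤ s * h := by gcongr
  have hc2 : 0 ≤ c ^ 2 := sq_nonneg c
  rcases hx with (rfl | rfl | rfl) | ⟨i, ⟨hio, hiv⟩, rfl | rfl | rfl | rfl⟩ <;>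
  rcases hσ with rfl | rfl <;>
  simp [inner_add_left, EuclideanSpace.inner_single_left, *, hov.symm] <;>
  nlinarith

end greedySteps

/-- For every `M > 0` and `d ≥ 3` there is a finite `d`-balanced set `X` of unit
vectors in `ℝ^d` (i.e. `0` is interior to `conv X`) admitting a valid farthest-point iteration
reaching length `≥ √M`; hence `u**(d, d) = ∞`. -/
theorem stmt15 (M : ℝ) (hM : 0 < M) (d : ℕ) (hd : 3 ≤ d) :
    ∃ X : Finset (EuclideanSpace ℝ (Fin d)),
      (∀ x ∈ X, ‖x‖ = 1) ∧
      (0 : EuclideanSpace ℝ (Fin d)) ∈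
        interior (convexHull ℝ (X : Set (EuclideanSpace ℝ (Fin d)))) ∧
      ∃ u : ℕ → EuclideanSpace ℝ (Fin d),
        u 0 = 0 ∧
        (∀ i, ∃ χ ∈ X, (∀ x ∈ X, ⟪χ, u i⟫ ≤ ⟪x, u i⟫) ∧ u (i + 1) = u i + χ) ∧
        ∃ i, Real.sqrt M ≤ ‖u i‖ := by
  set R := Real.sqrt M
  have hR : 0 ≤ R := Real.sqrt_nonneg M
  obtain ⟨o, v, p, hov, hpo, hpv⟩ : ∃ o v p : Fin d, o ≠ v ∧ p ≠ o ∧ p ≠ v :=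
    ⟨⟨0, by omega⟩, ⟨1, by omega⟩, ⟨2, by omega⟩, by simp, by simp, by simp⟩
  obtain ⟨ε, hε, hεR, hε1⟩ : ∃ ε : ℝ, 0 < ε ∧ ε * (R + 2) = 1 / 8 ∧ ε ≤ 1 / 16 := by
    refine ⟨1 / (8 * (R + 2)), by positivity, by field_simp, ?_⟩
    exact one_div_le_one_div_of_le (by norm_num) (by linarith)
  have hε2 : ε ^ 2 ≤ 1 / 256 := by nlinarith
  obtain ⟨c, hc, hcε⟩ : ∃ c : ℝ, 0 < c ∧ c ^ 2 + ε ^ 2 = 1 :=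
    ⟨√(1 - ε ^ 2), Real.sqrt_pos.2 (by linarith), by rw [Real.sq_sqrt (by linarith)]; ring⟩
  obtain ⟨s, hs, hcs⟩ : ∃ s : ℝ, 0 ≤ s ∧ (c / 2) ^ 2 + s ^ 2 = 1 :=
    ⟨√(1 - (c / 2) ^ 2), Real.sqrt_nonneg _, by
      rw [Real.sq_sqrt (by nlinarith)]; ring⟩
  have hs1 : s ≤ 1 := by nlinarith
  have hεs : ε ≤ s := by nlinarith
  let a : ℕ → EuclideanSpace ℝ (Fin d)
    | 0 => 0
    | k + 1 => EuclideanSpace.single o ((-1) ^ k * (c / 2)) + EuclideanSpace.single v (s + k * ε)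
  have hfin : (greedySteps o v c s ε).Finite := greedySteps_finite
  obtain ⟨n, hn⟩ : ∃ n : ℕ, n = ⌈R / ε⌉₊ := ⟨_, rfl⟩
  have hn1 : R ≤ n * ε := by
    rw [← div_le_iff₀ hε, hn]
    exact Nat.le_ceil _
  have hn2 : n * ε ≤ R + ε := by
    have h1 : (n : ℝ) < R / ε + 1 := by
      rw [hn]
      exact Nat.ceil_lt_add_one (by positivity)
    calc n * ε ≤ (R / ε + 1) * ε := by gcongr
      _ = R + ε := by field_simp
  have hstart : EuclideanSpace.single o (c / 2) + EuclideanSpace.single v s ∈ hfin.toFinset := by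
    rw [Set.Finite.mem_toFinset]
    exact Or.inl (by simp)
  obtain ⟨u, hua, hu⟩ := exists_greedy_extension hfin.toFinset ⟨_, hstart⟩ a (n + 1) (by
    rintro (_ | k) hk
    · exact ⟨_, hstart, by simp [a], by simp [a]⟩
    · have hσ : ((-1 : ℝ) ^ k = 1 ∨ (-1 : ℝ) ^ k = -1) := neg_one_pow_eq_or ℝ k
      have hkn : (k : ℝ) ≤ n := by exact_mod_cast (by omega : k ≤ n)
      refine ⟨EuclideanSpace.single o (-((-1) ^ k * c)) + EuclideanSpace.single v ε, ?_, ?_, ?_⟩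
      · rw [Set.Finite.mem_toFinset]
        rcases hσ with h | h <;> rw [h] <;> exact Or.inl (by simp)
      · intro x hx
        have hkε : k * ε ≤ n * ε := by gcongr
        refine greedySteps_min hov hε hεs (by positivity) ?_ hσ (hfin.mem_toFinset.1 hx)
        calc ε * (s + k * ε) ≤ ε * (R + 2) :=
            mul_le_mul_of_nonneg_left (by linarith) hε.le
          _ ≤ c ^ 2 / 4 := by linarith
      · ext j
        simp [a, pow_succ]
        split_ifs <;> ring)
  refine ⟨hfin.toFinset, fun x hx => norm_of_mem_greedySteps hov hcε hcs (hfin.mem_toFinset.1 hx),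
    ?_, u, hua 0 (Nat.zero_le _), hu, n + 1, ?_⟩
  · rw [hfin.coe_toFinset]
    exact zero_mem_interior_convexHull_greedySteps hov hpo hpv hc hε
  · rw [hua _ le_rfl]
    have h1 := PiLp.norm_apply_le (a (n + 1)) v
    have h2 : a (n + 1) v = s + n * ε := by simp [a, hov.symm]
    rw [h2, Real.norm_eq_abs] at h1
    linarith [le_abs_self (s + n * ε)]
end
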